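/- Let A be an m-homogeneous supersolvable line arrangement in ℙ² with m ≥ 3, having at least two modular points, with d = |A| lines. Then the number n₂ of double points of A satisfies n₂ ≥ d/2. -/

import Mathlib

open scoped LinearAlgebra.Projectivization

noncomputable section

attribute [local instance] Classical.propDecidable

/-- A point of the complex projective plane. -/
abbrev ProjPoint := ℙ ℂ (Fin 3 → ℂ)

/-- A line of the complex projective plane, encoded by a defining linear form
up to scalar, i.e. as a point of the dual projective plane. -/
abbrev ProjLine := ℙ ℂ (Module.Dual ℂ (Fin 3 → ℂ))

/-- The incidence relation between points and lines of `ℙ²`. -/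
def PointOnLine (p : ProjPoint) (L : ProjLine) : Prop :=
  L.rep p.rep = 0

/-- The multiplicity of a point with respect to a line arrangement:
the number of lines of the arrangement passing through the point. -/
def mult (A : Finset ProjLine) (p : ProjPoint) : ℕ :=
  Set.ncard {L : ProjLine | L ∈ A ∧ PointOnLine p L}

/-- An intersection point of a line arrangement: a point lying on at least two lines. -/
def IsIntersectionPoint (A : Finset ProjLine) (p : ProjPoint) : Prop :=
  2 ≤ mult A p

/-- A modular point: an intersection point `p` such that for any other intersection
point `q`, the line through `p` and `q` belongs to the arrangement. -/
def IsModular (A : Finset ProjLine) (p : ProjPoint) : Prop :=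
  IsIntersectionPoint A p ∧
    ∀ q : ProjPoint, IsIntersectionPoint A q → q ≠ p →
      ∃ L ∈ A, PointOnLine p L ∧ PointOnLine q L

/-- A supersolvable line arrangement: one possessing a modular point. -/
def IsSupersolvable (A : Finset ProjLine) : Prop :=
  ∃ p, IsModular A p

/-- An `m`-homogeneous supersolvable line arrangement: supersolvable, and all
modular points have multiplicity `m`. -/
def IsHomogSS (A : Finset ProjLine) (m : ℕ) : Prop :=
  IsSupersolvable A ∧ ∀ p, IsModular A p → mult A p = m

/-- `nk A k` is the number of intersection points of multiplicity `k` of `A`. -/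
def nk (A : Finset ProjLine) (k : ℕ) : ℕ :=
  Set.ncard {p : ProjPoint | IsIntersectionPoint A p ∧ mult A p = k}

/-- A pencil: all lines pass through a common point. -/
def IsPencil (A : Finset ProjLine) : Prop :=
  ∃ p, ∀ L ∈ A, PointOnLine p L

/-! Incidence lemmas -/

lemma pol_mk (X : Fin 3 → ℂ) (hX : X ≠ 0) (L : ProjLine) :
    PointOnLine (Projectivization.mk ℂ X hX) L ↔ L.rep X = 0 := by
  unfold PointOnLine
  obtain ⟨a, ha⟩ := Projectivization.exists_smul_eq_mk_rep ℂ X hX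
  rw [← ha, Units.smul_def, map_smul, smul_eq_mul]
  simp

lemma exists_inter (L M : ProjLine) : ∃ p, PointOnLine p L ∧ PointOnLine p M := by
  have hk : LinearMap.ker (L.rep.prod M.rep) ≠ ⊥ := by
    apply LinearMap.ker_ne_bot_of_finrank_lt
    simp
  obtain ⟨X, hX, h0⟩ := (Submodule.ne_bot_iff _).1 hk
  refine ⟨Projectivization.mk ℂ X h0, ?_, ?_⟩
  · rw [pol_mk]; simpa using congrArg Prod.fst (LinearMap.mem_ker.1 hX)
  · rw [pol_mk]; simpa using congrArg Prod.snd (LinearMap.mem_ker.1 hX)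

lemma line_unique {p q : ProjPoint} (hpq : p ≠ q) {L M : ProjLine}
    (hpL : PointOnLine p L) (hqL : PointOnLine q L)
    (hpM : PointOnLine p M) (hqM : PointOnLine q M) : L = M := by
  have hli : LinearIndependent ℂ ![p.rep, q.rep] := by
    have := (Projectivization.independent_pair_iff_ne p q).2 hpq
    rw [Projectivization.independent_iff] at this
    have e : ![p.rep, q.rep] = Projectivization.rep ∘ ![p, q] := by
      ext i; fin_cases i <;> rfl
    rw [e]
    exact this
  have hle : Submodule.span ℂ (Set.range ![p.rep, q.rep]) ≤ LinearMap.ker L.rep := by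
    rw [Submodule.span_le]
    rintro _ ⟨i, rfl⟩
    fin_cases i
    · exact hpL
    · exact hqL
  have hfs := finrank_span_eq_card hli
  have hR : ∃ R, L.rep R ≠ 0 := by
    by_contra hcon
    push Not at hcon
    exact L.rep_nonzero (LinearMap.ext hcon)
  obtain ⟨R, hR⟩ := hR
  have hker : Module.finrank ℂ (LinearMap.ker L.rep) ≤ 2 := by
    have h1 := L.rep.finrank_range_add_finrank_ker
    have h2 : 0 < Module.finrank ℂ (LinearMap.range L.rep) := by
      rw [Module.finrank_pos_iff]
      exact ⟨⟨L.rep R, ⟨R, rfl⟩⟩, 0, fun h => hR (congrArg Subtype.val h)⟩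
    simp only [Module.finrank_fin_fun] at h1
    omega
  have heq := Submodule.eq_of_le_of_finrank_le hle (by rw [hfs]; simpa using hker)
  have hMle : LinearMap.ker L.rep ≤ LinearMap.ker M.rep := by
    rw [← heq, Submodule.span_le]
    rintro _ ⟨i, rfl⟩
    fin_cases i
    · exact hpM
    · exact hqM
  rw [← L.mk_rep, ← M.mk_rep, Projectivization.mk_eq_mk_iff']
  have key : ∀ u, M.rep u * L.rep R = M.rep R * L.rep u := by
    intro u
    have : L.rep R • u - L.rep u • R ∈ LinearMap.ker M.rep := by
      apply hMle
      simp [mul_comm]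
    simp only [LinearMap.mem_ker, map_sub, map_smul, smul_eq_mul] at this
    linear_combination this
  have hMR : M.rep R ≠ 0 := by
    intro h0
    apply M.rep_nonzero
    refine LinearMap.ext fun u => ?_
    have := key u
    rw [h0, zero_mul] at this
    simpa [hR] using this
  refine ⟨L.rep R / M.rep R, LinearMap.ext fun u => ?_⟩
  have := key u
  simp only [LinearMap.smul_apply, smul_eq_mul]
  field_simp
  linear_combination this

lemma pt_unique {L M : ProjLine} (hLM : L ≠ M) {p q : ProjPoint}
    (hpL : PointOnLine p L) (hqL : PointOnLine q L)
    (hpM : PointOnLine p M) (hqM : PointOnLine q M) : p = q := by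
  by_contra hpq
  exact hLM (line_unique hpq hpL hqL hpM hqM)

lemma mult_eq (A : Finset ProjLine) (p : ProjPoint) :
    mult A p = (A.filter (fun L => PointOnLine p L)).card := by
  unfold mult
  rw [← Set.ncard_coe_finset]
  congr 1
  ext L
  simp

lemma isInt_of {A : Finset ProjLine} {p : ProjPoint} {L M : ProjLine} (hL : L ∈ A) (hM : M ∈ A)
    (hne : L ≠ M) (hpL : PointOnLine p L) (hpM : PointOnLine p M) : IsIntersectionPoint A p := by
  unfold IsIntersectionPoint
  rw [mult_eq]
  exact Finset.one_lt_card.2 ⟨L, by simp [hL, hpL], M, by simp [hM, hpM], hne⟩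

lemma mult_two {A : Finset ProjLine} {p : ProjPoint} {L M : ProjLine} (hL : L ∈ A) (hM : M ∈ A)
    (hne : L ≠ M) (hpL : PointOnLine p L) (hpM : PointOnLine p M)
    (hall : ∀ N ∈ A, PointOnLine p N → N = L ∨ N = M) : mult A p = 2 := by
  rw [mult_eq, Finset.card_eq_two]
  refine ⟨L, M, hne, ?_⟩
  ext N
  simp only [Finset.mem_filter, Finset.mem_insert, Finset.mem_singleton]
  constructor
  · rintro ⟨h1, h2⟩; exact hall N h1 h2
  · rintro (rfl | rfl)
    · exact ⟨hL, hpL⟩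
    · exact ⟨hM, hpM⟩

/-- The intersection point of two lines. -/
def meet (L M : ProjLine) : ProjPoint := (exists_inter L M).choose

lemma meet_left (L M : ProjLine) : PointOnLine (meet L M) L := (exists_inter L M).choose_spec.1
lemma meet_right (L M : ProjLine) : PointOnLine (meet L M) M := (exists_inter L M).choose_spec.2

lemma finite_int (A : Finset ProjLine) : {p | IsIntersectionPoint A p}.Finite := by
  apply ((A ×ˢ A).image (fun x => meet x.1 x.2)).finite_toSet.subset
  intro p hp
  have hp : 2 ≤ mult A p := hp
  rw [mult_eq] at hp
  obtain ⟨L, hL, M, hM, hne⟩ := Finset.one_lt_card.1 hp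
  simp only [Finset.mem_filter] at hL hM
  simp only [Finset.coe_image, Set.mem_image, Finset.mem_coe, Finset.mem_product]
  exact ⟨(L, M), ⟨hL.1, hM.1⟩,
    pt_unique hne (meet_left _ _) hL.2 (meet_right _ _) hM.2⟩

lemma card_le_nk {A : Finset ProjLine} (S : Finset ProjPoint) (hS : ∀ p ∈ S, mult A p = 2) :
    S.card ≤ nk A 2 := by
  unfold nk
  rw [← Set.ncard_coe_finset]
  apply Set.ncard_le_ncard
  · intro p hp
    have := hS p hp
    exact ⟨this.ge, this⟩
  · exact (finite_int A).subset fun p hp => hp.1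

/-- Lines through `p` other than `H`. -/
def thr (A : Finset ProjLine) (p : ProjPoint) (H : ProjLine) : Finset ProjLine :=
  A.filter (fun L => PointOnLine p L ∧ L ≠ H)

/-- Lines through neither `p` nor `q`. -/
def oth (A : Finset ProjLine) (p q : ProjPoint) : Finset ProjLine :=
  A.filter (fun L => ¬ PointOnLine p L ∧ ¬ PointOnLine q L)

lemma exists_sigma {A : Finset ProjLine} {p q : ProjPoint} {H : ProjLine}
    (hq : IsModular A q)
    (hpH : PointOnLine p H) {L v : ProjLine} (hL : L ∈ oth A p q)
    (hv : v ∈ thr A p H) : ∃ w ∈ thr A q H, PointOnLine (meet L v) w := by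
  simp only [oth, thr, Finset.mem_filter] at *
  obtain ⟨hLA, hLp, hLq⟩ := hL
  obtain ⟨hvA, hvp, hvH⟩ := hv
  have hne : L ≠ v := by rintro rfl; exact hLp hvp
  have hint : IsIntersectionPoint A (meet L v) :=
    isInt_of hLA hvA hne (meet_left _ _) (meet_right _ _)
  have hmq : meet L v ≠ q := by
    intro h; exact hLq (h ▸ meet_left L v)
  obtain ⟨w, hwA, hqw, hmw⟩ := hq.2 _ hint hmq
  refine ⟨w, ⟨hwA, hqw, ?_⟩, hmw⟩
  rintro rfl
  have := pt_unique hvH (meet_right L v) hvp hmw hpH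
  exact hLp (this ▸ meet_left L v)

lemma card_thr {A : Finset ProjLine} {p : ProjPoint} {H : ProjLine} (hH : H ∈ A)
    (hpH : PointOnLine p H) : (thr A p H).card + 1 = mult A p := by
  have : thr A p H = (A.filter (fun L => PointOnLine p L)).erase H := by
    ext L; simp [thr]; tauto
  rw [mult_eq, this]
  exact Finset.card_erase_add_one (by simp [hH, hpH])

lemma card_split {A : Finset ProjLine} {p q : ProjPoint} {H : ProjLine} (hpq : p ≠ q)
    (hH : H ∈ A) (hpH : PointOnLine p H) (hqH : PointOnLine q H) :
    A.card = 1 + (thr A p H).card + (thr A q H).card + (oth A p q).card := by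
  have hA : A = (({H} ∪ thr A p H) ∪ thr A q H) ∪ oth A p q := by
    ext L
    simp only [thr, oth, Finset.mem_union, Finset.mem_filter, Finset.mem_singleton]
    constructor
    · intro h; tauto
    · rintro (((rfl | h) | h) | h)
      · exact hH
      all_goals exact h.1
  conv_lhs => rw [hA]
  rw [Finset.card_union_of_disjoint, Finset.card_union_of_disjoint, Finset.card_union_of_disjoint,
    Finset.card_singleton]
  · rw [Finset.disjoint_left]; intro L h1 h2; simp [thr] at h1 h2; tauto
  · rw [Finset.disjoint_left]; intro L h1 h2
    simp only [thr, Finset.mem_union, Finset.mem_filter, Finset.mem_singleton] at h1 h2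
    rcases h1 with h1 | h1
    · exact h2.2.2 h1
    · exact h1.2.2 (line_unique hpq h1.2.1 h2.2.1 hpH hqH)
  · rw [Finset.disjoint_left]; intro L h1 h2
    simp only [thr, oth, Finset.mem_union, Finset.mem_filter, Finset.mem_singleton] at h1 h2
    rcases h1 with (rfl | h1) | h1 <;> tauto

/-- All the other lines are concurrent (at the centroid of the grid). -/
lemma concurrent {A : Finset ProjLine} {p q : ProjPoint} {H : ProjLine} (hpq : p ≠ q)
    (hpH : PointOnLine p H) (hqH : PointOnLine q H)
    (hcard : (thr A p H).card = (thr A q H).card) (hpos : 0 < (thr A p H).card)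
    (σ : ProjLine → ProjLine → ProjLine)
    (hσ : ∀ L ∈ oth A p q, ∀ v ∈ thr A p H, σ L v ∈ thr A q H ∧ PointOnLine (meet L v) (σ L v)) :
    ∃ c, ¬ PointOnLine c H ∧ ∀ L ∈ oth A p q, PointOnLine c L := by
  have hR : ∃ R, H.rep R ≠ 0 := by
    by_contra hcon
    push Not at hcon
    exact H.rep_nonzero (LinearMap.ext hcon)
  obtain ⟨R, hR⟩ := hR
  set V := thr A p H with hV
  set W := thr A q H with hW
  let x : ProjLine → ℂ := fun w => - w.rep R / w.rep p.rep
  let y : ProjLine → ℂ := fun v => - v.rep R / v.rep q.rep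
  have hHp : H.rep p.rep = 0 := hpH
  have hHq : H.rep q.rep = 0 := hqH
  set C : Fin 3 → ℂ := (∑ w ∈ W, x w) • p.rep + (∑ v ∈ V, y v) • q.rep + (V.card : ℂ) • R with hC
  have hHC : H.rep C ≠ 0 := by
    simp only [hC, map_add, map_smul, hHp, hHq, smul_eq_mul, mul_zero, zero_add]
    exact mul_ne_zero (by exact_mod_cast hpos.ne') hR
  have hC0 : C ≠ 0 := by intro h; rw [h, map_zero] at hHC; exact hHC rfl
  refine ⟨Projectivization.mk ℂ C hC0, by rw [pol_mk]; exact hHC, ?_⟩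
  intro L hL
  rw [pol_mk]
  have hpt : ∀ v ∈ V, x (σ L v) * L.rep p.rep + y v * L.rep q.rep + L.rep R = 0 := by
    intro v hv
    obtain ⟨hw, hmw⟩ := hσ L hL v hv
    simp only [hV, hW, thr, Finset.mem_filter] at hv hw
    have hvq : v.rep q.rep ≠ 0 := fun h0 => hv.2.2 (line_unique hpq hv.2.1 h0 hpH hqH)
    have hwp : (σ L v).rep p.rep ≠ 0 := fun h0 => hw.2.2 (line_unique hpq h0 hw.2.1 hpH hqH)
    have hvp : v.rep p.rep = 0 := hv.2.1
    have hwq : (σ L v).rep q.rep = 0 := hw.2.1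
    set X : Fin 3 → ℂ := x (σ L v) • p.rep + y v • q.rep + R with hX
    have hX0 : X ≠ 0 := by
      intro h
      have : H.rep X = 0 := by rw [h, map_zero]
      simp [hX, hHp, hHq] at this
      exact hR this
    have h1 : PointOnLine (Projectivization.mk ℂ X hX0) v := by
      rw [pol_mk]
      simp only [hX, map_add, map_smul, smul_eq_mul, hvp, y]
      field_simp
      ring
    have h2 : PointOnLine (Projectivization.mk ℂ X hX0) (σ L v) := by
      rw [pol_mk]
      simp only [hX, map_add, map_smul, smul_eq_mul, hwq, x]
      field_simp
      ring
    have hne : v ≠ σ L v := by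
      intro h; rw [← h] at hwp; exact hwp hvp
    have h3 := pt_unique hne h1 (meet_right L v) h2 hmw
    have h4 := meet_left L v
    rw [← h3, pol_mk] at h4
    simpa [hX] using h4
  have hinj : Set.InjOn (σ L) V := by
    intro v hv v' hv' he
    obtain ⟨hw, hmw⟩ := hσ L hL v hv
    obtain ⟨hw', hmw'⟩ := hσ L hL v' hv'
    rw [← he] at hmw'
    simp only [hV, hW, thr, oth, Finset.mem_coe, Finset.mem_filter] at hv hv' hw hL
    have hne : L ≠ σ L v := by intro h; rw [← h] at hw; exact hL.2.2 hw.2.1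
    have h1 := pt_unique hne (meet_left L v) (meet_left L v') hmw hmw'
    have hne2 : meet L v ≠ p := by intro h; exact hL.2.1 (h ▸ meet_left L v)
    exact line_unique hne2 (meet_right L v) hv.2.1 (h1 ▸ meet_right L v') hv'.2.1
  have himg : V.image (σ L) = W := by
    apply Finset.eq_of_subset_of_card_le
    · intro w hw
      obtain ⟨v, hv, rfl⟩ := Finset.mem_image.1 hw
      exact (hσ L hL v hv).1
    · rw [Finset.card_image_of_injOn hinj, hcard]
  have hsum := Finset.sum_eq_zero hpt
  rw [Finset.sum_add_distrib, Finset.sum_add_distrib, ← Finset.sum_mul, ← Finset.sum_mul,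
    Finset.sum_const, nsmul_eq_mul, ← Finset.sum_image (f := x) hinj, himg] at hsum
  simpa [hC] using hsum

/-- Main counting: number of double points versus blocked grid positions. -/
lemma count {A : Finset ProjLine} {p q : ProjPoint} {H : ProjLine} (hpq : p ≠ q)
    (hH : H ∈ A)
    (hpH : PointOnLine p H) (hqH : PointOnLine q H)
    (c : ProjPoint) (hcH : ¬ PointOnLine c H) (hc : ∀ L ∈ oth A p q, PointOnLine c L)
    (B : Finset (ProjLine × ProjLine))
    (hB : ∀ L ∈ oth A p q, ∀ v ∈ thr A p H, ∀ w ∈ thr A q H,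
      PointOnLine (meet v w) L → (v, w) ∈ B) :
    (oth A p q).card + (thr A p H).card * (thr A q H).card ≤ nk A 2 + B.card := by
  set V := thr A p H with hV
  set W := thr A q H with hW
  set O := oth A p q with hO
  have mV : ∀ {v}, v ∈ V ↔ v ∈ A ∧ PointOnLine p v ∧ v ≠ H := by
    intro v; simp [hV, thr]
  have mW : ∀ {v}, v ∈ W ↔ v ∈ A ∧ PointOnLine q v ∧ v ≠ H := by
    intro v; simp [hW, thr]
  have mO : ∀ {v}, v ∈ O ↔ v ∈ A ∧ ¬ PointOnLine p v ∧ ¬ PointOnLine q v := by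
    intro v; simp [hO, oth]
  have hVq : ∀ {v}, v ∈ V → ¬ PointOnLine q v := fun hv h0 =>
    (mV.1 hv).2.2 (line_unique hpq (mV.1 hv).2.1 h0 hpH hqH)
  have hWp : ∀ {v}, v ∈ W → ¬ PointOnLine p v := fun hv h0 =>
    (mW.1 hv).2.2 (line_unique hpq h0 (mW.1 hv).2.1 hpH hqH)
  have hcase : ∀ N ∈ A, N = H ∨ N ∈ V ∨ N ∈ W ∨ N ∈ O := by
    intro N hN
    rw [mV, mW, mO]; tauto
  have hVW : ∀ {v w}, v ∈ V → w ∈ W → v ≠ w := by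
    rintro v w hv hw rfl; exact hWp hw (mV.1 hv).2.1
  have hgH : ∀ {v w}, v ∈ V → w ∈ W → ¬ PointOnLine (meet v w) H := by
    intro v w hv hw h
    have := pt_unique (mV.1 hv).2.2 (meet_left v w) (mV.1 hv).2.1 h hpH
    exact hWp hw (this ▸ meet_right v w)
  have hgV : ∀ {v w v'}, v ∈ V → w ∈ W → v' ∈ V → PointOnLine (meet v w) v' → v' = v := by
    intro v w v' hv hw hv' h
    have hne : meet v w ≠ p := fun h0 => hgH hv hw (h0 ▸ hpH)
    exact line_unique hne h (mV.1 hv').2.1 (meet_left v w) (mV.1 hv).2.1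
  have hgW : ∀ {v w w'}, v ∈ V → w ∈ W → w' ∈ W → PointOnLine (meet v w) w' → w' = w := by
    intro v w v' hv hw hv' h
    have hne : meet v w ≠ q := fun h0 => hgH hv hw (h0 ▸ hqH)
    exact line_unique hne h (mW.1 hv').2.1 (meet_right v w) (mW.1 hw).2.1
  set G := (V ×ˢ W) \ B with hG
  let S1 := G.image (fun z => meet z.1 z.2)
  let S2 := O.image (fun L => meet L H)
  have hOH : ∀ {L}, L ∈ O → L ≠ H := by
    rintro L hL rfl; exact (mO.1 hL).2.1 hpH
  have hinf : ∀ {L L'}, L ∈ O → L' ∈ O → PointOnLine (meet L H) L' → L' = L := by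
    intro L L' hL hL' h
    have hne : meet L H ≠ c := fun h0 => hcH (h0 ▸ meet_right L H)
    exact line_unique hne h (hc L' hL') (meet_left L H) (hc L hL)
  have c1 : S1.card = G.card := by
    apply Finset.card_image_of_injOn
    rintro ⟨v, w⟩ h ⟨v', w'⟩ h' he
    simp only [hG, Finset.coe_sdiff, Finset.mem_coe, Set.mem_sdiff, Finset.mem_product] at h h' he
    have e1 := hgV h.1.1 h.1.2 h'.1.1 (he ▸ meet_left v' w')
    have e2 := hgW h.1.1 h.1.2 h'.1.2 (he ▸ meet_right v' w')
    rw [e1, e2]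
  have c2 : S2.card = O.card := by
    apply Finset.card_image_of_injOn
    intro L hL L' hL' he
    have he : meet L H = meet L' H := he
    exact (hinf hL hL' (he ▸ meet_left L' H)).symm
  have hdis : Disjoint S1 S2 := by
    rw [Finset.disjoint_left]
    intro z h1 h2
    obtain ⟨⟨v, w⟩, hvw, rfl⟩ := Finset.mem_image.1 h1
    obtain ⟨L, hL, he⟩ := Finset.mem_image.1 h2
    simp only [hG, Finset.mem_sdiff, Finset.mem_product] at hvw he
    exact hgH hvw.1.1 hvw.1.2 (he ▸ meet_right L H)
  have hS : (S1 ∪ S2).card ≤ nk A 2 := by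
    apply card_le_nk
    intro z hzS
    rcases Finset.mem_union.1 hzS with h1 | h2
    · obtain ⟨⟨v, w⟩, hvw, rfl⟩ := Finset.mem_image.1 h1
      simp only [hG, Finset.mem_sdiff, Finset.mem_product] at hvw ⊢
      obtain ⟨⟨hv, hw⟩, hn⟩ := hvw
      apply mult_two (mV.1 hv).1 (mW.1 hw).1 (hVW hv hw) (meet_left v w) (meet_right v w)
      intro N hN hz
      rcases hcase N hN with rfl | h | h | h
      · exact absurd hz (hgH hv hw)
      · exact Or.inl (hgV hv hw h hz)
      · exact Or.inr (hgW hv hw h hz)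
      · exact absurd (hB N h v hv w hw hz) hn
    · obtain ⟨L, hL, rfl⟩ := Finset.mem_image.1 h2
      apply mult_two (mO.1 hL).1 hH (hOH hL) (meet_left L H) (meet_right L H)
      intro N hN hz
      rcases hcase N hN with rfl | h | h | h
      · exact Or.inr rfl
      · have := pt_unique (mV.1 h).2.2 hz (mV.1 h).2.1 (meet_right L H) hpH
        exact absurd (this ▸ meet_left L H) (mO.1 hL).2.1
      · have := pt_unique (mW.1 h).2.2 hz (mW.1 h).2.1 (meet_right L H) hqH
        exact absurd (this ▸ meet_left L H) (mO.1 hL).2.2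
      · exact Or.inl (hinf hL h hz)
  rw [Finset.card_union_of_disjoint hdis, c1, c2] at hS
  have hle := Finset.le_card_sdiff B (V ×ˢ W)
  rw [Finset.card_product] at hle
  change _ ≤ G.card at hle
  omega

lemma main_nat (A : Finset ProjLine) (m : ℕ) (hm : 3 ≤ m)
    (h : IsHomogSS A m)
    (h2 : ∃ p q : ProjPoint, p ≠ q ∧ IsModular A p ∧ IsModular A q) :
    A.card ≤ 2 * nk A 2 := by
  obtain ⟨p, q, hpq, hp, hq⟩ := h2
  obtain ⟨H, hH, hpH, hqH⟩ := hp.2 q hq.1 hpq.symm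
  have cV := card_thr hH hpH
  have cW := card_thr hH hqH
  rw [h.2 p hp] at cV
  rw [h.2 q hq] at cW
  have cA := card_split hpq hH hpH hqH
  have hex : ∀ L v, ∃ w, L ∈ oth A p q → v ∈ thr A p H →
      w ∈ thr A q H ∧ PointOnLine (meet L v) w := by
    intro L v
    by_cases h1 : L ∈ oth A p q ∧ v ∈ thr A p H
    · obtain ⟨w, hw⟩ := exists_sigma hq hpH h1.1 h1.2
      exact ⟨w, fun _ _ => hw⟩
    · exact ⟨H, fun a b => absurd ⟨a, b⟩ h1⟩
  choose σ hσ using hex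
  obtain ⟨c, hcH, hc⟩ := concurrent hpq hpH hqH (by omega) (by omega) σ
    (fun L hL v hv => hσ L v hL hv)
  set V := thr A p H with hV
  set W := thr A q H with hW
  set O := oth A p q with hO
  have mV : ∀ {v}, v ∈ V ↔ v ∈ A ∧ PointOnLine p v ∧ v ≠ H := by
    intro v; simp [hV, thr]
  have mW : ∀ {v}, v ∈ W ↔ v ∈ A ∧ PointOnLine q v ∧ v ≠ H := by
    intro v; simp [hW, thr]
  have mO : ∀ {v}, v ∈ O ↔ v ∈ A ∧ ¬ PointOnLine p v ∧ ¬ PointOnLine q v := by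
    intro v; simp [hO, oth]
  have hσu : ∀ L ∈ O, ∀ v ∈ V, ∀ w ∈ W, PointOnLine (meet v w) L → w = σ L v := by
    intro L hL v hv w hw hz
    obtain ⟨h1, h3⟩ := hσ L v hL hv
    have hne : L ≠ v := by rintro rfl; exact (mO.1 hL).2.1 (mV.1 hv).2.1
    have e := pt_unique hne hz (meet_left L v) (meet_left v w) (meet_right L v)
    have hne2 : meet L v ≠ q := fun h0 => (mO.1 hL).2.2 (h0 ▸ meet_left L v)
    exact line_unique hne2 (e ▸ meet_right v w) (mW.1 hw).2.1 h3 (mW.1 h1).2.1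
  by_cases hk : O.card ≤ 1
  · have := count hpq hH hpH hqH c hcH hc ((O ×ˢ V).image (fun z => (z.2, σ z.1 z.2))) (by
      intro L hL v hv w hw hz
      rw [Finset.mem_image]
      refine ⟨(L, v), Finset.mem_product.2 ⟨hL, hv⟩, ?_⟩
      rw [hσu L hL v hv w hw hz])
    have hb := Finset.card_image_le (s := O ×ˢ V) (f := fun z => (z.2, σ z.1 z.2))
    rw [Finset.card_product] at hb
    have hVW : W.card = V.card := by omega
    have hV2 : 2 ≤ V.card := by omega
    rw [← hV, ← hW, ← hO, hVW] at this
    rw [hVW] at cA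
    generalize O.card = k at *
    interval_cases k <;> nlinarith
  · push Not at hk
    obtain ⟨L1, hL1, L2, hL2, hne⟩ := Finset.one_lt_card.1 hk
    have hcI : IsIntersectionPoint A c :=
      isInt_of (mO.1 hL1).1 (mO.1 hL2).1 hne (hc _ hL1) (hc _ hL2)
    have hcp : c ≠ p := fun h0 => hcH (h0 ▸ hpH)
    have hcq : c ≠ q := fun h0 => hcH (h0 ▸ hqH)
    obtain ⟨v0, hv0A, hpv0, hcv0⟩ := hp.2 c hcI hcp
    obtain ⟨w0, hw0A, hqw0, hcw0⟩ := hq.2 c hcI hcq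
    have hv0 : v0 ∈ V := mV.2 ⟨hv0A, hpv0, fun h0 => hcH (h0 ▸ hcv0)⟩
    have hw0 : w0 ∈ W := mW.2 ⟨hw0A, hqw0, fun h0 => hcH (h0 ▸ hcw0)⟩
    -- bound on k
    have hkb : O.card + 1 ≤ W.card := by
      obtain ⟨v, hv, hvne⟩ := Finset.exists_mem_ne (show 1 < V.card by omega) v0
      have hcv : ¬ PointOnLine c v := fun h0 =>
        hvne (line_unique hcp h0 (mV.1 hv).2.1 hcv0 hpv0)
      rw [← Finset.card_erase_add_one hw0]
      apply Nat.succ_le_succ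
      apply Finset.card_le_card_of_injOn (fun L => σ L v)
      · intro L hL
        obtain ⟨h1, h3⟩ := hσ L v hL hv
        refine Finset.mem_coe.2 (Finset.mem_erase.2 ⟨?_, h1⟩)
        intro h0
        have h0 : σ L v = w0 := h0
        rw [h0] at h3
        have hne : L ≠ w0 := by rintro rfl; exact (mO.1 hL).2.2 hqw0
        have e := pt_unique hne (meet_left L v) (hc L hL) h3 hcw0
        exact hcv (e ▸ meet_right L v)
      · intro L hL L' hL' he
        have he : σ L v = σ L' v := he
        obtain ⟨h1, h3⟩ := hσ L v hL hv
        obtain ⟨h1', h3'⟩ := hσ L' v hL' hv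
        rw [← he] at h3'
        have hvw : v ≠ σ L v := by
          intro h0
          exact (mV.1 hv).2.2 (line_unique hpq (mV.1 hv).2.1
            (h0 ▸ (mW.1 h1).2.1) hpH hqH)
        have e := pt_unique hvw (meet_right L v) (meet_right L' v) h3 h3'
        have hne2 : meet L v ≠ c := fun h0 => hcv (h0 ▸ meet_right L v)
        exact line_unique hne2 (meet_left L v) (hc L hL) (e ▸ meet_left L' v) (hc L' hL')
    have := count hpq hH hpH hqH c hcH hc
      (insert (v0, w0) ((O ×ˢ V.erase v0).image (fun z => (z.2, σ z.1 z.2)))) (by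
      intro L hL v hv w hw hz
      rw [Finset.mem_insert, Finset.mem_image]
      by_cases hvv : v = v0
      · left
        subst hvv
        have hne : L ≠ v := by rintro rfl; exact (mO.1 hL).2.1 hpv0
        have e := pt_unique hne hz (hc L hL) (meet_left v w) hcv0
        have : w = w0 := line_unique hcq (e ▸ meet_right v w) (mW.1 hw).2.1 hcw0 hqw0
        rw [this]
      · right
        refine ⟨(L, v), Finset.mem_product.2 ⟨hL, Finset.mem_erase.2 ⟨hvv, hv⟩⟩, ?_⟩
        rw [hσu L hL v hv w hw hz])
    have hb := Finset.card_image_le (s := O ×ˢ V.erase v0) (f := fun z => (z.2, σ z.1 z.2))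
    have hb2 := Finset.card_insert_le (v0, w0)
      ((O ×ˢ V.erase v0).image (fun z => (z.2, σ z.1 z.2)))
    have he := Finset.card_erase_add_one hv0
    rw [Finset.card_product] at hb
    have hVW : W.card = V.card := by omega
    rw [← hV, ← hW, ← hO, hVW] at this
    rw [hVW] at cA hkb
    generalize O.card = k at *
    generalize (V.erase v0).card = e at *
    rw [← he] at this cA hkb
    obtain ⟨t, rfl⟩ := Nat.exists_eq_add_of_le (show k ≤ e by omega)
    have h3 : k + (k + t + 1) * (k + t + 1) ≤ nk A 2 + (k * (k + t) + 1) := by omega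
    nlinarith [Nat.zero_le (k * t), Nat.zero_le (t * t)]

/-- An `m`-homogeneous supersolvable line arrangement (`m ≥ 3`)
with at least two modular points and `d` lines satisfies `n₂ ≥ d/2`. -/
theorem n2_ge_half_of_two_modular (A : Finset ProjLine) (m : ℕ) (hm : 3 ≤ m)
    (h : IsHomogSS A m)
    (h2 : ∃ p q : ProjPoint, p ≠ q ∧ IsModular A p ∧ IsModular A q) :
    (A.card : ℝ) / 2 ≤ (nk A 2 : ℝ) := by
  have := main_nat A m hm h h2
  have h3 : (A.card : ℝ) ≤ 2 * (nk A 2 : ℝ) := by exact_mod_cast this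
  linarith

end
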